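/- Let G be a connected graph of minimum degree 2 and let S, T ⊆ E(G). Then CFI_S(G) and CFI_T(G) are isomorphic (as graphs respecting the gadget coloring) if and only if |S| ≡ |T| (mod 2). -/

import Mathlib

open SimpleGraph
open scoped Classical

/-- Pair vertices `a(v,w)` (Bool `false`) and `b(v,w)` (Bool `true`) of the CFI
construction, one pair for every directed edge `(v,w)` of `G`. -/
abbrev CFIPair {V : Type*} (G : SimpleGraph V) :=
  {q : Bool × V × V // G.Adj q.2.1 q.2.2}

/-- Middle vertices `m_A` of the CFI construction: for each vertex `v` and each
even-cardinality subset `A` of the neighbours of `v`. -/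
abbrev CFIMid {V : Type*} (G : SimpleGraph V) :=
  {m : V × Set V // m.2 ⊆ G.neighborSet m.1 ∧ Even m.2.ncard}

abbrev CFIVert {V : Type*} (G : SimpleGraph V) := CFIPair G ⊕ CFIMid G

/-- The Cai–Fürer–Immerman graph `CFI_T(G)`. -/
def CFI {V : Type*} (G : SimpleGraph V) (T : Set (Sym2 V)) : SimpleGraph (CFIVert G) :=
  SimpleGraph.fromRel (fun x y =>
    match x, y with
    | Sum.inr m, Sum.inl p =>
        p.val.2.1 = m.val.1 ∧
        ((p.val.1 = false ∧ p.val.2.2 ∈ m.val.2) ∨ (p.val.1 = true ∧ p.val.2.2 ∉ m.val.2))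
    | Sum.inl p, Sum.inl q =>
        p.val.2.1 = q.val.2.2 ∧ p.val.2.2 = q.val.2.1 ∧
        ((s(p.val.2.1, p.val.2.2) ∉ T ∧ p.val.1 = q.val.1) ∨
         (s(p.val.2.1, p.val.2.2) ∈ T ∧ p.val.1 ≠ q.val.1))
    | _, _ => False)

namespace CFI

variable {V : Type*} {G : SimpleGraph V} {S T : Set (Sym2 V)}

theorem not_adj_inr_inr (m m' : CFIMid G) : ¬ (CFI G T).Adj (Sum.inr m) (Sum.inr m') := by
  simp [CFI]

theorem adj_inr_inl (m : CFIMid G) (p : CFIPair G) :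
    (CFI G T).Adj (Sum.inr m) (Sum.inl p) ↔
      p.val.2.1 = m.val.1 ∧ (p.val.1 = false ↔ p.val.2.2 ∈ m.val.2) := by
  cases h : p.val.1 <;> simp [CFI, h]

theorem adj_inl_inl (p q : CFIPair G) :
    (CFI G T).Adj (Sum.inl p) (Sum.inl q) ↔
      p.val.2.1 = q.val.2.2 ∧ p.val.2.2 = q.val.2.1 ∧
        (p.val.1 = q.val.1 ↔ s(p.val.2.1, p.val.2.2) ∉ T) := by
  obtain ⟨⟨b, v, w⟩, hp⟩ := p
  obtain ⟨⟨c, x, y⟩, hq⟩ := q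
  simp only at hp hq
  simp only [CFI, fromRel_adj, ne_eq, Sum.inl.injEq, Subtype.mk.injEq, Prod.mk.injEq]
  constructor
  · rintro ⟨-, ⟨rfl, rfl, h⟩ | ⟨rfl, rfl, h⟩⟩
    · exact ⟨rfl, rfl, by tauto⟩
    · rw [Sym2.eq_swap] at h
      exact ⟨rfl, rfl, by tauto⟩
  · rintro ⟨rfl, rfl, h⟩
    exact ⟨fun h' => hp.ne h'.2.1, Or.inl ⟨rfl, rfl, by tauto⟩⟩

/-- `F v` lists the neighbours `w` for which the pair `a(v,w), b(v,w)` is to be swapped in order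
to turn `CFI G S` into `CFI G T`. -/
structure IsFlip (G : SimpleGraph V) (S T : Set (Sym2 V)) (F : V → Set V) : Prop where
  subset (v : V) : F v ⊆ G.neighborSet v
  even (v : V) : Even (F v).ncard
  twist {v w : V} : G.Adj v w →
    ((w ∈ F v ↔ v ∈ F w) ↔ (s(v, w) ∈ S ↔ s(v, w) ∈ T))

section Parity

theorem natCast_ncard {α : Type*} [Fintype α] (s : Set α) :
    (s.ncard : ZMod 2) = ∑ x, if x ∈ s then 1 else 0 := by
  rw [Finset.sum_boole, Set.ncard_eq_toFinset_card']
  congr 2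
  ext
  simp

theorem even_ncard_iff {α : Type*} [Fintype α] (s : Set α) :
    Even s.ncard ↔ ∑ x, (if x ∈ s then 1 else 0 : ZMod 2) = 0 := by
  rw [← natCast_ncard, ZMod.natCast_eq_zero_iff_even]

theorem even_ncard_symmDiff {α : Type*} [Fintype α] {s t : Set α} (hs : Even s.ncard)
    (ht : Even t.ncard) : Even (symmDiff s t).ncard := by
  rw [even_ncard_iff] at *
  have hst := congrArg₂ (· + ·) hs ht
  simp only [← Finset.sum_add_distrib, add_zero] at hst
  refine (Finset.sum_congr rfl fun x _ => ?_).trans hst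
  by_cases h : x ∈ s <;> by_cases h' : x ∈ t <;> simp [Set.mem_symmDiff, h, h'] <;> decide

end Parity

section Iso

variable [Fintype V]

/-- Swap the pairs selected by `F`, and shift the middle vertices accordingly. -/
noncomputable def flipMap {F : V → Set V} (h : IsFlip G S T F) : CFIVert G → CFIVert G
  | Sum.inl p => Sum.inl ⟨(xor p.val.1 (decide (p.val.2.2 ∈ F p.val.2.1)), p.val.2), p.2⟩
  | Sum.inr m => Sum.inr ⟨(m.val.1, symmDiff m.val.2 (F m.val.1)),
      fun _ hx => (Set.mem_symmDiff.1 hx).elim (fun hx => m.2.1 hx.1) (fun hx => h.subset _ hx.1),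
      even_ncard_symmDiff m.2.2 (h.even _)⟩

theorem flipMap_involutive {F : V → Set V} (h : IsFlip G S T F) :
    Function.Involutive (flipMap h) := by
  rintro (p | m)
  · simp [flipMap]
  · simp [flipMap, symmDiff_symmDiff_cancel_right]

theorem flipMap_adj_iff {F : V → Set V} (h : IsFlip G S T F) (x y : CFIVert G) :
    (CFI G T).Adj (flipMap h x) (flipMap h y) ↔ (CFI G S).Adj x y := by
  have mid (m : CFIMid G) (p : CFIPair G) :
      (CFI G T).Adj (flipMap h (Sum.inr m)) (flipMap h (Sum.inl p)) ↔
        (CFI G S).Adj (Sum.inr m) (Sum.inl p) := by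
    simp only [flipMap, adj_inr_inl]
    refine and_congr_right fun hv => ?_
    rw [← hv, Set.mem_symmDiff]
    by_cases h' : p.val.2.2 ∈ F p.val.2.1 <;> cases p.val.1 <;> simp [h']
  rcases x with p | m <;> rcases y with q | m'
  · simp only [flipMap, adj_inl_inl]
    refine and_congr_right fun h₁ => and_congr_right fun h₂ => ?_
    have := h.twist p.2
    rw [← h₁, ← h₂]
    generalize p.val.1 = b
    generalize q.val.1 = c
    by_cases hb : p.val.2.2 ∈ F p.val.2.1 <;> by_cases hc : p.val.2.1 ∈ F p.val.2.2 <;>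
      simp only [hb, hc, decide_true, decide_false] at this ⊢ <;> cases b <;> cases c <;>
      simp <;> tauto
  · rw [SimpleGraph.adj_comm, mid, SimpleGraph.adj_comm]
  · exact mid m q
  · simp [flipMap, not_adj_inr_inr]

theorem exists_iso_iff_exists_isFlip :
    (∃ φ : CFI G S ≃g CFI G T,
      (∀ m : CFIMid G, ∃ m' : CFIMid G,
        φ (Sum.inr m) = Sum.inr m' ∧ m'.val.1 = m.val.1) ∧
      (∀ p : CFIPair G, ∃ p' : CFIPair G,
        φ (Sum.inl p) = Sum.inl p' ∧ p'.val.2 = p.val.2)) ↔ ∃ F, IsFlip G S T F := by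
  constructor
  · rintro ⟨φ, hmid, hpair⟩
    choose μ hμ hμ' using hmid
    choose π hπ hπ' using hpair
    have hπinj : Function.Injective π := fun p q hpq => by
      have : φ (Sum.inl p) = φ (Sum.inl q) := by rw [hπ, hπ, hpq]
      simpa using this
    let m₀ (v : V) : CFIMid G := ⟨(v, ∅), by simp, by simp⟩
    have key {v w : V} (hvw : G.Adj v w) :
        (π ⟨(true, v, w), hvw⟩).val.1 = false ↔ w ∈ (μ (m₀ v)).val.2 := by
      have h₀ : (CFI G S).Adj (Sum.inr (m₀ v)) (Sum.inl ⟨(true, v, w), hvw⟩) := by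
        simp [adj_inr_inl, m₀]
      rw [← φ.map_adj_iff, hμ, hπ, adj_inr_inl, hπ'] at h₀
      exact h₀.2
    refine ⟨fun v => (μ (m₀ v)).val.2, fun v => ?_, fun v => (μ (m₀ v)).2.2, ?_⟩
    · have := (μ (m₀ v)).2.1
      rwa [hμ'] at this
    · intro v w hvw
      have h₁ := key hvw
      have h₂ := key hvw.symm
      have h₃ : (CFI G S).Adj (Sum.inl ⟨(true, v, w), hvw⟩) (Sum.inl ⟨(true, w, v), hvw.symm⟩) ↔
          s(v, w) ∉ S := by simp [adj_inl_inl]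
      rw [← φ.map_adj_iff, hπ, hπ, adj_inl_inl, hπ', hπ'] at h₃
      simp only [true_and] at h₃
      rw [← h₁, ← h₂]
      revert h₃
      generalize (π ⟨(true, v, w), hvw⟩).val.1 = b
      generalize (π ⟨(true, w, v), hvw.symm⟩).val.1 = c
      cases b <;> cases c <;> simp <;> tauto
  · rintro ⟨F, h⟩
    exact ⟨⟨(flipMap_involutive h).toPerm, fun {x y} => flipMap_adj_iff h x y⟩,
      fun _ => ⟨_, rfl, rfl⟩, fun _ => ⟨_, rfl, rfl⟩⟩

end Iso

section Flip

variable [Fintype V]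

/-- Orient each edge both ways: the weights of the two darts add up to the weight of the edge. -/
theorem sum_sum_eq_sum_edge {M : Type*} [AddCommMonoid M] {f : V → V → M} {c : Sym2 V → M}
    (hf : ∀ v w, ¬ G.Adj v w → f v w = 0) (hc : ∀ e, e ∉ G.edgeSet → c e = 0)
    (hfc : ∀ v w, G.Adj v w → f v w + f w v = c s(v, w)) :
    ∑ v, ∑ w, f v w = ∑ e, c e := by
  have h₁ : ∑ v, ∑ w, f v w = ∑ d : G.Dart, f d.fst d.snd := by
    rw [← Fintype.sum_prod_type']
    symm
    refine Finset.sum_of_injOn (fun d : G.Dart => d.toProd)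
      (SimpleGraph.Dart.toProd_injective.injOn) (by simp) ?_ (by simp)
    rintro ⟨v, w⟩ - h
    refine hf v w fun hvw => h ⟨⟨(v, w), hvw⟩, by simp⟩
  rw [h₁, ← Finset.sum_fiberwise Finset.univ (fun d : G.Dart => d.edge)]
  refine Finset.sum_congr rfl fun e _ => ?_
  by_cases he : e ∈ G.edgeSet
  · induction e with | _ v w =>
    let d : G.Dart := ⟨(v, w), he⟩
    rw [← hfc v w he]
    have : (Finset.univ.filter fun d' : G.Dart => d'.edge = s(v, w)) = {d, d.symm} :=
      d.edge_fiber
    rw [this, Finset.sum_pair d.symm_ne.symm]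
    rfl
  · rw [hc e he, Finset.filter_false_of_mem, Finset.sum_empty]
    rintro d - rfl
    exact he d.edge_mem

theorem exists_symm_sum_eq_single_add_single {u v : V} (p : G.Walk u v) :
    ∃ g : V → V → ZMod 2, (∀ x y, ¬ G.Adj x y → g x y = 0) ∧ (∀ x y, g x y = g y x) ∧
      ∀ x, ∑ y, g x y = (if x = u then 1 else 0) + (if x = v then 1 else 0) := by
  induction p with
  | nil => exact ⟨0, by simp, by simp, by simp [CharTwo.add_self_eq_zero]⟩
  | @cons u v w h p ih =>
    obtain ⟨g, h₀, hs, hg⟩ := ih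
    refine ⟨fun x y => g x y + if s(x, y) = s(u, v) then 1 else 0, ?_, ?_, ?_⟩
    · intro x y hxy
      beta_reduce
      rw [h₀ x y hxy, if_neg, add_zero]
      intro he
      exact hxy (by rwa [← G.mem_edgeSet, he])
    · intro x y
      beta_reduce
      rw [hs, Sym2.eq_swap]
    · intro x
      have : ∑ y, (if s(x, y) = s(u, v) then 1 else 0 : ZMod 2) =
          (if x = u then 1 else 0) + (if x = v then 1 else 0) := by
        have huv := h.ne
        by_cases hu : x = u
        · subst hu
          simp [huv]
        · by_cases hv : x = v
          · subst hv
            simp [hu]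
          · simp [hu, hv]
      rw [Finset.sum_add_distrib, hg, this]
      linear_combination CharTwo.add_self_eq_zero (if x = v then 1 else 0 : ZMod 2)

theorem exists_symm_sum_eq (hconn : G.Connected) {d : V → ZMod 2} (hd : ∑ v, d v = 0) :
    ∃ g : V → V → ZMod 2, (∀ x y, ¬ G.Adj x y → g x y = 0) ∧ (∀ x y, g x y = g y x) ∧
      ∀ x, ∑ y, g x y = d x := by
  obtain ⟨r⟩ := hconn.nonempty
  choose g h₀ hs hg using fun v =>
    exists_symm_sum_eq_single_add_single (hconn.preconnected v r).some
  refine ⟨fun x y => ∑ v, d v * g v x y, ?_, ?_, ?_⟩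
  · intro x y hxy
    simp [h₀ _ x y hxy]
  · intro x y
    simp only [hs _ x y]
  · intro x
    rw [Finset.sum_comm]
    simp only [← Finset.mul_sum, hg, mul_add, Finset.sum_add_distrib, ← Finset.sum_mul, hd]
    simp

theorem exists_sum_eq_zero_iff (hconn : G.Connected) {c : Sym2 V → ZMod 2}
    (hc : ∀ e, e ∉ G.edgeSet → c e = 0) :
    (∃ f : V → V → ZMod 2, (∀ v w, ¬ G.Adj v w → f v w = 0) ∧
      (∀ v w, G.Adj v w → f v w + f w v = c s(v, w)) ∧ ∀ v, ∑ w, f v w = 0) ↔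
      ∑ e, c e = 0 := by
  constructor
  · rintro ⟨f, hf, hfc, h⟩
    rw [← sum_sum_eq_sum_edge hf hc hfc]
    simp [h]
  · intro h
    let i := Fintype.equivFin V
    let f (v w : V) : ZMod 2 := if i v < i w then c s(v, w) else 0
    have hf (v w : V) (hvw : ¬ G.Adj v w) : f v w = 0 := by
      simp [f, hc s(v, w) hvw]
    have hfc (v w : V) (hvw : G.Adj v w) : f v w + f w v = c s(v, w) := by
      rcases lt_or_gt_of_ne (i.injective.ne hvw.ne) with hlt | hlt
      · simp [f, hlt, hlt.not_gt]
      · simp [f, hlt, hlt.not_gt, Sym2.eq_swap]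
    rw [← sum_sum_eq_sum_edge hf hc hfc] at h
    obtain ⟨g, h₀, hs, hg⟩ := exists_symm_sum_eq hconn h
    refine ⟨fun v w => f v w + g v w, ?_, ?_, ?_⟩
    · intro v w hvw
      simp [hf v w hvw, h₀ v w hvw]
    · intro v w hvw
      beta_reduce
      rw [hs w v, ← hfc v w hvw]
      linear_combination CharTwo.add_self_eq_zero (g v w)
    · intro v
      rw [Finset.sum_add_distrib, hg, CharTwo.add_self_eq_zero]

theorem exists_isFlip_iff (hconn : G.Connected) (hS : S ⊆ G.edgeSet) (hT : T ⊆ G.edgeSet) :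
    (∃ F, IsFlip G S T F) ↔ S.ncard % 2 = T.ncard % 2 := by
  let c (e : Sym2 V) : ZMod 2 := (if e ∈ S then 1 else 0) + (if e ∈ T then 1 else 0)
  have hc (e : Sym2 V) (he : e ∉ G.edgeSet) : c e = 0 := by
    simp [c, mt (@hS e) he, mt (@hT e) he]
  have hsum : ∑ e, c e = 0 ↔ S.ncard % 2 = T.ncard % 2 := by
    rw [Finset.sum_add_distrib, ← natCast_ncard, ← natCast_ncard, CharTwo.add_eq_zero,
      ZMod.natCast_eq_natCast_iff']
  rw [← hsum, ← exists_sum_eq_zero_iff hconn hc]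
  constructor
  · rintro ⟨F, hF⟩
    refine ⟨fun v w => if w ∈ F v then 1 else 0, ?_, ?_, fun v => (even_ncard_iff _).1 (hF.even v)⟩
    · intro v w hvw
      exact if_neg fun h => hvw (hF.subset v h)
    · intro v w hvw
      have := hF.twist hvw
      by_cases h₁ : w ∈ F v <;> by_cases h₂ : v ∈ F w <;> by_cases h₃ : s(v, w) ∈ S <;>
        by_cases h₄ : s(v, w) ∈ T <;> simp [h₁, h₂, h₃, h₄, c] at this ⊢ <;> decide
  · rintro ⟨f, hf, hfc, h⟩
    have h01 (a : ZMod 2) : (if a = 1 then 1 else 0) = a := by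
      revert a
      decide
    refine ⟨fun v => {w | f v w = 1}, ?_, ?_, ?_⟩
    · intro v w hw
      by_contra hvw
      rw [Set.mem_ofPred_eq, hf v w hvw] at hw
      exact zero_ne_one hw
    · intro v
      simp only [even_ncard_iff, Set.mem_ofPred_eq]
      exact (Finset.sum_congr rfl fun w _ => by convert h01 (f v w)).trans (h v)
    · intro v w hvw
      have := hfc v w hvw
      simp only [Set.mem_ofPred_eq]
      simp only [c] at this
      revert this
      generalize f v w = a
      generalize f w v = b
      by_cases h₃ : s(v, w) ∈ S <;> by_cases h₄ : s(v, w) ∈ T <;> simp only [h₃, h₄, if_true,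
        if_false] <;> revert a b <;> decide

end Flip

end CFI

theorem stmt16 {V : Type*} [Fintype V] (G : SimpleGraph V) (hconn : G.Connected)
    (hmin : ∀ v : V, 2 ≤ (G.neighborSet v).ncard)
    (S T : Set (Sym2 V)) (hS : S ⊆ G.edgeSet) (hT : T ⊆ G.edgeSet) :
    (∃ φ : CFI G S ≃g CFI G T,
      (∀ m : CFIMid G, ∃ m' : CFIMid G,
        φ (Sum.inr m) = Sum.inr m' ∧ m'.val.1 = m.val.1) ∧
      (∀ p : CFIPair G, ∃ p' : CFIPair G,
        φ (Sum.inl p) = Sum.inl p' ∧ p'.val.2 = p.val.2)) ↔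
    S.ncard % 2 = T.ncard % 2 :=
  CFI.exists_iso_iff_exists_isFlip.trans (CFI.exists_isFlip_iff hconn hS hT)
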